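/- Let S be a scheme and let (X_i) be a filtered projective system of quasi-compact S-schemes whose transition morphisms are affine. Then the projective limit X := lim_i X_i exists in the category of S-schemes and is a quasi-compact S-scheme. -/

import Mathlib

open CategoryTheory AlgebraicGeometry Limits Opposite

universe u

namespace AlgebraicGeometry.Scheme

/-- A diagram of affine schemes indexed by a small category has a limit in schemes. -/
lemma hasLimit_of_isAffine {J : Type u} [Category.{u} J] (F : J ⥤ Scheme.{u})
    [∀ j, IsAffine (F.obj j)] : HasLimit F := by
  let e : F ⟶ (F ⋙ Scheme.Γ.rightOp) ⋙ Scheme.Spec := Functor.whiskerLeft F ΓSpec.adjunction.unit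
  have (j : J) : IsIso (e.app j) := IsAffine.affine
  have : IsIso e := NatIso.isIso_of_isIso_app e
  exact ⟨⟨_, (IsLimit.postcomposeInvEquiv (asIso e) _).symm
    (isLimitOfPreserves Scheme.Spec (limit.isLimit (F ⋙ Scheme.Γ.rightOp)))⟩⟩

variable {J : Type u} [Category.{u} J]

/-- A limit of the diagram `F` over the open subscheme `U` of `F.obj j₀`: a cone whose leg at `j₀`
factors through `U` and which is universal among such cones. -/
structure LimitOver (F : J ⥤ Scheme.{u}) (j₀ : J) (U : (F.obj j₀).Opens) where
  /-- The underlying cone. -/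
  cone : Cone F
  /-- The factorization of the leg at `j₀` through `U`. -/
  toOpen : cone.pt ⟶ (U : Scheme.{u})
  toOpen_ι : toOpen ≫ U.ι = cone.π.app j₀
  /-- The universal morphism. -/
  lift (s : Cone F) (p : s.pt ⟶ (U : Scheme.{u})) (hp : p ≫ U.ι = s.π.app j₀) : s.pt ⟶ cone.pt
  fac (s : Cone F) (p : s.pt ⟶ (U : Scheme.{u})) (hp : p ≫ U.ι = s.π.app j₀) (j : J) :
    lift s p hp ≫ cone.π.app j = s.π.app j
  hom_ext {T : Scheme.{u}} (f g : T ⟶ cone.pt)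
    (h : ∀ j, f ≫ cone.π.app j = g ≫ cone.π.app j) : f = g

namespace LimitOver

attribute [simp] toOpen_ι fac

variable {F : J ⥤ Scheme.{u}} {j₀ : J}

/-- The transition morphism between limits over nested open subschemes. -/
noncomputable def map {U V : (F.obj j₀).Opens} (L : LimitOver F j₀ U) (M : LimitOver F j₀ V)
    (h : U ≤ V) : L.cone.pt ⟶ M.cone.pt :=
  M.lift L.cone (L.toOpen ≫ (F.obj j₀).homOfLE h) (by simp)

@[simp]
lemma map_π {U V : (F.obj j₀).Opens} (L : LimitOver F j₀ U) (M : LimitOver F j₀ V)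
    (h : U ≤ V) (j : J) : L.map M h ≫ M.cone.π.app j = L.cone.π.app j :=
  M.fac _ _ _ _

lemma map_toOpen {U V : (F.obj j₀).Opens} (L : LimitOver F j₀ U) (M : LimitOver F j₀ V)
    (h : U ≤ V) : L.map M h ≫ M.toOpen = L.toOpen ≫ (F.obj j₀).homOfLE h := by
  simp [← cancel_mono V.ι]

lemma isPullback_map {U V : (F.obj j₀).Opens} (L : LimitOver F j₀ U) (M : LimitOver F j₀ V)
    (h : U ≤ V) : IsPullback (L.map M h) L.toOpen M.toOpen ((F.obj j₀).homOfLE h) := by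
  have key (s : PullbackCone M.toOpen ((F.obj j₀).homOfLE h)) :
      s.snd ≫ U.ι = s.fst ≫ M.cone.π.app j₀ := by
    rw [← M.toOpen_ι, s.condition_assoc, homOfLE_ι]
  let l (s : PullbackCone M.toOpen ((F.obj j₀).homOfLE h)) : s.pt ⟶ L.cone.pt :=
    L.lift (M.cone.extend s.fst) s.snd (by simpa using key s)
  have hl (s) (j : J) : l s ≫ L.cone.π.app j = s.fst ≫ M.cone.π.app j :=
    (L.fac _ _ _ j).trans (by simp)
  refine ⟨⟨L.map_toOpen M h⟩, ⟨PullbackCone.IsLimit.mk _ l ?_ ?_ ?_⟩⟩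
  · exact fun s ↦ M.hom_ext _ _ fun j ↦ by simp [hl]
  · exact fun s ↦ by rw [← cancel_mono U.ι, Category.assoc, L.toOpen_ι, hl, key]
  · exact fun s m h₁ _ ↦ L.hom_ext _ _ fun j ↦ by rw [hl, ← h₁]; simp

variable (L : ∀ U : (F.obj j₀).affineOpens, LimitOver F j₀ U.1)

/-- The limits over all affine opens of `F.obj j₀`, as a relative gluing datum. -/
noncomputable def relativeGluingData : (F.obj j₀).directedAffineCover.RelativeGluingData where
  functor :=
    { obj U := (L U).cone.pt
      map {U V} h := (L U).map (L V) h.le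
      map_id U := (L U).hom_ext _ _ fun j ↦ ((L U).map_π (L U) le_rfl j).trans (by simp)
      map_comp {U V W} f g := (L W).hom_ext _ _ fun j ↦
        ((L U).map_π (L W) (f ≫ g).le j).trans <| by
          rw [Category.assoc, (L V).map_π (L W) g.le, (L U).map_π (L V) f.le] }
  natTrans :=
    { app U := (L U).toOpen
      naturality U V h := (L U).map_toOpen (L V) h.le }
  equifibered U V h := (L U).isPullback_map (L V) h.le

/-- The cone on `F` glued from the limits over all affine opens of `F.obj j₀`. -/
noncomputable def gluedCone : Cone F where
  pt := (relativeGluingData L).glued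
  π :=
    { app j := colimit.desc (relativeGluingData L).functor
        { pt := F.obj j
          ι :=
            { app U := (L U).cone.π.app j
              naturality U V h := by
                simpa using! (L U).map_π (L V) h.le j } }
      naturality i j f := colimit.hom_ext fun U ↦ by
        refine Eq.trans ?_ (Category.assoc _ _ _)
        simp [-Cone.w, ((L U).cone.w f).symm]
        rfl }

/-- The morphism from the limit over an affine open to the glued cone. -/
noncomputable def toGlued (U : (F.obj j₀).affineOpens) : (L U).cone.pt ⟶ (gluedCone L).pt :=
  colimit.ι (relativeGluingData L).functor U

@[simp]
lemma toGlued_π (U : (F.obj j₀).affineOpens) (j : J) :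
    toGlued L U ≫ (gluedCone L).π.app j = (L U).cone.π.app j :=
  colimit.ι_desc _ _

lemma gluedCone_π_base : (gluedCone L).π.app j₀ = (relativeGluingData L).toBase :=
  colimit.hom_ext fun U ↦ (toGlued_π L U j₀).trans <| by
    rw [Cover.RelativeGluingData.ι_toBase]
    exact (L U).toOpen_ι.symm

lemma isPullback_toGlued (U : (F.obj j₀).affineOpens) :
    IsPullback (L U).toOpen (toGlued L U) U.1.ι ((gluedCone L).π.app j₀) := by
  rw [gluedCone_π_base]
  exact (relativeGluingData L).isPullback_natTrans_ι_toBase U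

lemma gluedCone_hom_ext {T : Scheme.{u}} (a b : T ⟶ (gluedCone L).pt)
    (h : ∀ j, a ≫ (gluedCone L).π.app j = b ≫ (gluedCone L).π.app j) : a = b := by
  refine Cover.hom_ext ((F.obj j₀).directedAffineCover.pullback₁ (a ≫ (gluedCone L).π.app j₀))
    _ _ fun (U : (F.obj j₀).affineOpens) ↦ ?_
  change pullback.fst (a ≫ (gluedCone L).π.app j₀) U.1.ι ≫ a = pullback.fst _ _ ≫ b
  have w := pullback.condition (f := a ≫ (gluedCone L).π.app j₀) (g := U.1.ι)
  have P := isPullback_toGlued L U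
  rw [← P.lift_snd (pullback.snd _ _) (pullback.fst _ _ ≫ a) (by simp [← w]),
    ← P.lift_snd (pullback.snd _ _) (pullback.fst _ _ ≫ b) (by simp [← w, h])]
  congr 1
  refine (L U).hom_ext _ _ fun j ↦ ?_
  simp only [← toGlued_π, IsPullback.lift_snd_assoc, Category.assoc, h]

/-- The morphism to the glued cone from the part of a cone lying over an affine open. -/
noncomputable def liftOn (s : Cone F) (U : (F.obj j₀).affineOpens) :
    pullback (s.π.app j₀) U.1.ι ⟶ (gluedCone L).pt :=
  (L U).lift (s.extend (pullback.fst _ _)) (pullback.snd _ _) (by simp [pullback.condition]) ≫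
    toGlued L U

@[simp]
lemma liftOn_π (s : Cone F) (U : (F.obj j₀).affineOpens) (j : J) :
    liftOn L s U ≫ (gluedCone L).π.app j = pullback.fst _ _ ≫ s.π.app j := by
  simp [liftOn]

/-- The morphism from a cone to the glued cone. -/
noncomputable def gluedLift (s : Cone F) : s.pt ⟶ (gluedCone L).pt :=
  Cover.glueMorphisms ((F.obj j₀).directedAffineCover.pullback₁ (s.π.app j₀))
    (liftOn L s) fun U V ↦ gluedCone_hom_ext L _ _ fun j ↦ by
      refine (Category.assoc _ _ _).trans (Eq.trans ?_ (Category.assoc _ _ _).symm)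
      refine (congrArg (_ ≫ ·) (liftOn_π L s U j)).trans
        (Eq.trans ?_ (congrArg (_ ≫ ·) (liftOn_π L s V j)).symm)
      exact pullback.condition_assoc _

@[simp]
lemma fst_gluedLift (s : Cone F) (U : (F.obj j₀).affineOpens) :
    pullback.fst (s.π.app j₀) U.1.ι ≫ gluedLift L s = liftOn L s U :=
  Cover.ι_glueMorphisms ((F.obj j₀).directedAffineCover.pullback₁ (s.π.app j₀)) _ _ U

@[simp]
lemma gluedLift_π (s : Cone F) (j : J) : gluedLift L s ≫ (gluedCone L).π.app j = s.π.app j := by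
  refine Cover.hom_ext ((F.obj j₀).directedAffineCover.pullback₁ (s.π.app j₀)) _ _
    fun (U : (F.obj j₀).affineOpens) ↦ ?_
  change pullback.fst (s.π.app j₀) U.1.ι ≫ _ = pullback.fst (s.π.app j₀) U.1.ι ≫ _
  rw [← Category.assoc, fst_gluedLift, liftOn_π]

/-- The glued cone is a limit cone. -/
noncomputable def isLimitGluedCone : IsLimit (gluedCone L) where
  lift s := gluedLift L s
  fac s j := gluedLift_π L s j
  uniq s m hm := gluedCone_hom_ext L _ _ fun j ↦ by rw [hm, gluedLift_π]

end LimitOver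

variable {D : J ⥤ Scheme.{u}} {i : J} {U : (D.obj i).Opens}

lemma π_comp_map_hom (s : Cone (Over.forget i ⋙ D)) (j : Over i) :
    (s.π.app j : s.pt ⟶ D.obj j.left) ≫ D.map j.hom = s.π.app (Over.mk (𝟙 i)) :=
  s.w (Over.homMk j.hom : j ⟶ Over.mk (𝟙 i))

lemma range_π_subset (s : Cone (Over.forget i ⋙ D)) (p : s.pt ⟶ (U : Scheme.{u}))
    (hp : p ≫ U.ι = s.π.app (Over.mk (𝟙 i))) (j : Over i) :
    Set.range (s.π.app j) ⊆ Set.range ((opensDiagramι D i U).app j) := by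
  refine subset_of_subset_of_eq ?_ (Opens.range_ι (D.map j.hom ⁻¹ᵁ U)).symm
  rintro _ ⟨x, rfl⟩
  have h : (D.map j.hom) ((s.π.app j : s.pt ⟶ D.obj j.left) x) = U.ι (p x) := by
    simpa using! congrArg (fun f : s.pt ⟶ D.obj i ↦ f x) ((π_comp_map_hom s j).trans hp.symm)
  change (D.map j.hom) ((s.π.app j : s.pt ⟶ D.obj j.left) x) ∈ U
  exact h ▸ (p x).2

/-- A cone whose leg at `i` factors through `U` restricts to a cone on the diagram of preimages
of `U`. -/
noncomputable def opensConeOfFactors (s : Cone (Over.forget i ⋙ D)) (p : s.pt ⟶ (U : Scheme.{u}))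
    (hp : p ≫ U.ι = s.π.app (Over.mk (𝟙 i))) : Cone (opensDiagram D i U) where
  pt := s.pt
  π :=
    { app j := IsOpenImmersion.lift ((opensDiagramι D i U).app j) (s.π.app j)
        (range_π_subset s p hp j)
      naturality j k f := by
        rw [← cancel_mono ((opensDiagramι D i U).app k), Category.assoc, Category.assoc,
          IsOpenImmersion.lift_fac, (opensDiagramι D i U).naturality,
          IsOpenImmersion.lift_fac_assoc]
        exact s.π.naturality f }

lemma opensConeOfFactors_π_ι (s : Cone (Over.forget i ⋙ D)) (p : s.pt ⟶ (U : Scheme.{u}))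
    (hp : p ≫ U.ι = s.π.app (Over.mk (𝟙 i))) (j : Over i) :
    (opensConeOfFactors s p hp).π.app j ≫ (opensDiagramι D i U).app j = s.π.app j :=
  IsOpenImmersion.lift_fac _ _ _

/-- For a diagram `D` with affine transition morphisms, the limit over an affine open of `D.obj i`
exists. -/
noncomputable def limitOverOfIsAffineOpen
    [H : ∀ {i j} (f : i ⟶ j), IsAffineHom (D.map f)] (hU : IsAffineOpen U) :
    LimitOver (Over.forget i ⋙ D) (Over.mk (𝟙 i)) U :=
  have (j : Over i) : IsAffine ((opensDiagram D i U).obj j) :=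
    have : IsAffineHom (D.map j.hom) := H j.hom
    hU.preimage (D.map j.hom)
  have : HasLimit (opensDiagram D i U) := hasLimit_of_isAffine _
  { cone := (Cone.postcompose (opensDiagramι D i U)).obj (limit.cone (opensDiagram D i U))
    toOpen := limit.π (opensDiagram D i U) (Over.mk (𝟙 i)) ≫
      (D.map (𝟙 i)).resLE U (D.map (𝟙 i) ⁻¹ᵁ U) le_rfl
    toOpen_ι := by
      refine (Category.assoc _ _ _).trans (congrArg (_ ≫ ·) ?_)
      exact (Hom.resLE_comp_ι _ _).trans (by simp)
    lift s p hp := limit.lift (opensDiagram D i U) (opensConeOfFactors s p hp)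
    fac s p hp j := (limit.lift_π_assoc _ _ _).trans (opensConeOfFactors_π_ι s p hp j)
    hom_ext f g h := limit.hom_ext (F := opensDiagram D i U) fun j ↦ by
      rw [← cancel_mono ((opensDiagramι D i U).app j)]
      simpa using! h j }

/-- A cofiltered diagram of schemes with affine transition morphisms has a limit. -/
lemma hasLimit_of_isAffineHom [IsCofiltered J] (D : J ⥤ Scheme.{u})
    [∀ {i j} (f : i ⟶ j), IsAffineHom (D.map f)] : HasLimit D := by
  obtain ⟨i⟩ := IsCofiltered.nonempty (C := J)
  have : HasLimit (Over.forget i ⋙ D) :=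
    ⟨⟨_, LimitOver.isLimitGluedCone fun U ↦ limitOverOfIsAffineOpen U.2⟩⟩
  exact Functor.Initial.hasLimit_of_comp (Over.forget i)

end AlgebraicGeometry.Scheme

theorem filtered_projective_limit_of_quasicompact_schemes_along_affine_transitions_exists
    (S : Scheme.{u}) (I : Type u) [Preorder I] [IsDirected I (· ≤ ·)] [Nonempty I]
    (X : Iᵒᵖ ⥤ Over S)
    (hqc : ∀ i : I, CompactSpace ((X.obj (op i)).left))
    (haff : ∀ (i j : I) (h : i ≤ j), IsAffineHom ((X.map (homOfLE h).op).left)) :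
    ∃ c : LimitCone X, CompactSpace c.cone.pt.left := by
  let D : Iᵒᵖ ⥤ Scheme.{u} := X ⋙ Over.forget S
  have (i : Iᵒᵖ) : CompactSpace (D.obj i) := hqc i.unop
  have {i j : Iᵒᵖ} (f : i ⟶ j) : IsAffineHom (D.map f) := haff _ _ f.unop.le
  have : IsConnected Iᵒᵖ := IsCofiltered.isConnected _
  have : HasLimit D := Scheme.hasLimit_of_isAffineHom D
  have : HasLimit X := hasLimit_of_created X (Over.forget S)
  exact ⟨⟨_, limit.isLimit X⟩,
    Scheme.compactSpace_of_isLimit D _ (isLimitOfPreserves (Over.forget S) (limit.isLimit X))⟩
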